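/- Let (G,P) = Γ_{J∈Λ}(G_J,P_J) be a graph product of quasi-lattice ordered groups and let φ : G → ⊕_{J∈Λ} G_J be the homomorphism restricting to the identity on each G_J. Suppose x, y ∈ P satisfy x ∨ y ≠ ∞ and, for an arbitrary choice of I ∈ Λ, write x = x_I x′ and y = y_I y′. Then φ(x)_I ∨ φ(y)_I = (x_I ∨ y_I)·(φ(x′)_I ∨ φ(y′)_I), where all joins of elements of G_I are taken in the quasi-lattice ordered group (G_I,P_I) and φ(u)_I denotes the I-coordinate of φ(u). -/

import Mathlib

universe u v

/-- A syllable: a vertex `I` of the graph together with a nontrivial element of `G I`. -/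
def Syllable {Λ : Type u} (G : Λ → Type v) [∀ I, Group (G I)] : Type (max u v) :=
  Σ I : Λ, {g : G I // g ≠ 1}

section Words

variable {Λ : Type u} {G : Λ → Type v} [∀ I, Group (G I)]

/-- A single shuffle: swap two consecutive syllables with adjacent vertices. -/
def ShuffleStep (adj : Λ → Λ → Prop) (L L' : List (Syllable G)) : Prop :=
  ∃ (A B : List (Syllable G)) (s t : Syllable G),
    adj s.1 t.1 ∧ L = A ++ s :: t :: B ∧ L' = A ++ t :: s :: B

/-- Shuffle equivalence: finitely many shuffles. -/
def ShuffleEquiv (adj : Λ → Λ → Prop) : List (Syllable G) → List (Syllable G) → Prop :=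
  Relation.ReflTransGen (ShuffleStep adj)

/-- An expression admits an amalgamation iff it has two consecutive syllables at the
same vertex. -/
def Amalgamable (L : List (Syllable G)) : Prop :=
  ∃ (A B : List (Syllable G)) (s t : Syllable G), s.1 = t.1 ∧ L = A ++ s :: t :: B

/-- An expression is reduced iff it is not shuffle equivalent to an expression
admitting an amalgamation. -/
def Reduced (adj : Λ → Λ → Prop) (L : List (Syllable G)) : Prop :=
  ¬ ∃ L', ShuffleEquiv adj L L' ∧ Amalgamable L'

/-- The syllable at position `i` is an initial syllable of the expression `L`:
its vertex is adjacent to the vertices of all earlier syllables. -/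
def InitialAt (adj : Λ → Λ → Prop) (L : List (Syllable G)) (i : Fin L.length) : Prop :=
  ∀ j : Fin L.length, j < i → adj (L.get j).1 (L.get i).1

end Words

section GroupPart

variable {Λ : Type u} (adj : Λ → Λ → Prop) (G : Λ → Type v) [∀ I, Group (G I)]

/-- The graph product of the family of groups `G` over the graph `adj`: the quotient of
the free product by the normal closure of the commutators coming from adjacent vertices. -/
def GraphProduct : Type (max u v) :=
  Monoid.CoprodI G ⧸ Subgroup.normalClosure
    {g : Monoid.CoprodI G | ∃ (I J : Λ) (x : G I) (y : G J), adj I J ∧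
      g = Monoid.CoprodI.of x * Monoid.CoprodI.of y *
          (Monoid.CoprodI.of x)⁻¹ * (Monoid.CoprodI.of y)⁻¹}

instance : Group (GraphProduct adj G) :=
  inferInstanceAs (Group (_ ⧸ _))

/-- The canonical image in the graph product of an element of one of the groups. -/
def mkOf {I : Λ} (g : G I) : GraphProduct adj G :=
  QuotientGroup.mk (Monoid.CoprodI.of g)

/-- Evaluation of an expression (a word in the syllables) in the graph product. -/
def evalWord (L : List (Syllable G)) : GraphProduct adj G :=
  (L.map fun s => mkOf adj G (s.2.1 : G s.1)).prod

/-- `L` is an expression for the group element `x`. -/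
def ExprFor (L : List (Syllable G)) (x : GraphProduct adj G) : Prop :=
  evalWord adj G L = x

/-- `s` is an initial syllable of the group element `x`: some reduced expression for `x`
has `s` as an initial syllable. -/
def IsInitialSyllable (x : GraphProduct adj G) (s : Syllable G) : Prop :=
  ∃ L, Reduced adj L ∧ ExprFor adj G L x ∧ ∃ i : Fin L.length, InitialAt adj L i ∧ L.get i = s

/-- `s` is a final syllable of the group element `x`: it is an initial syllable of the
reverse of some reduced expression for `x`. -/
def IsFinalSyllable (x : GraphProduct adj G) (s : Syllable G) : Prop :=
  ∃ L, Reduced adj L ∧ ExprFor adj G L x ∧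
    ∃ i : Fin L.reverse.length, InitialAt adj L.reverse i ∧ L.reverse.get i = s

/-- `I` is an initial vertex of the group element `x`, i.e. `I ∈ Δ(x)`. -/
def InitialVertexOf (x : GraphProduct adj G) (I : Λ) : Prop :=
  ∃ s : Syllable G, IsInitialSyllable adj G x s ∧ s.1 = I

/-- `I` is a final vertex of the group element `x`, i.e. `I ∈ Δʳ(x)`. -/
def FinalVertexOf (x : GraphProduct adj G) (I : Λ) : Prop :=
  ∃ s : Syllable G, IsFinalSyllable adj G x s ∧ s.1 = I

/-- `I` is a vertex of the group element `x`: some (hence any) reduced expression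
for `x` has a syllable at the vertex `I`. -/
def VertexOf (x : GraphProduct adj G) (I : Λ) : Prop :=
  ∃ L, Reduced adj L ∧ ExprFor adj G L x ∧ ∃ s ∈ L, Sigma.fst s = I

/-- `c` is the element `x_I ∈ G_I`: either `c` is nontrivial and the initial syllable of
`x` at the vertex `I`, or `c = 1` and `I` is not an initial vertex of `x`. -/
def InitialPart (x : GraphProduct adj G) (I : Λ) (c : G I) : Prop :=
  (∃ h : c ≠ 1, IsInitialSyllable adj G x ⟨I, ⟨c, h⟩⟩) ∨ (c = 1 ∧ ¬ InitialVertexOf adj G x I)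

/-- The positive cone of the graph product of partially ordered groups: the submonoid
generated by the union of the positive cones of the factors. -/
def posCone (Pc : ∀ I, Submonoid (G I)) : Submonoid (GraphProduct adj G) :=
  Submonoid.closure {g | ∃ (I : Λ) (p : G I), p ∈ Pc I ∧ g = mkOf adj G p}

end GroupPart

section Order

variable {H : Type*} [Group H]

/-- `x ≤ y` in the left-invariant partial order determined by the cone `P`. -/
def lle (P : Submonoid H) (x y : H) : Prop := x⁻¹ * y ∈ P

/-- `x ≤ᵣ y` in the right-invariant partial order determined by the cone `P`. -/
def rle (P : Submonoid H) (x y : H) : Prop := y * x⁻¹ ∈ P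

/-- `x` and `y` have a common upper bound for the left-invariant order. -/
def HasUB (P : Submonoid H) (x y : H) : Prop := ∃ z, lle P x z ∧ lle P y z

/-- `m` is a least upper bound of `x` and `y` for the left-invariant order. -/
def IsLub' (P : Submonoid H) (x y m : H) : Prop :=
  lle P x m ∧ lle P y m ∧ ∀ w, lle P x w → lle P y w → lle P m w

/-- `w` is a greatest lower bound of `u` and `v` for the right-invariant order. -/
def IsRGlb (P : Submonoid H) (u v w : H) : Prop :=
  rle P w u ∧ rle P w v ∧ ∀ z, rle P z u → rle P z v → rle P z w

/-- `(H,P)` is a partially ordered group: `P ∩ P⁻¹ = {1}`. -/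
def IsPoGroup (P : Submonoid H) : Prop := ∀ x : H, x ∈ P → x⁻¹ ∈ P → x = 1

/-- `(H,P)` is a quasi-lattice ordered group: it is a partially ordered group in which
every pair of elements with a common upper bound has a least upper bound. -/
def IsQLO (P : Submonoid H) : Prop :=
  IsPoGroup P ∧ ∀ x y : H, HasUB P x y → ∃ m, IsLub' P x y m

end Order

/-- The homomorphism `φ` from the graph product to the direct product `∀ I, G I`,
restricting to the identity on each factor (each factor is sent to the corresponding
coordinate). -/
def phi {Λ : Type u} [DecidableEq Λ] (adj : Λ → Λ → Prop) (G : Λ → Type v)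
    [∀ I, Group (G I)] (hirr : ∀ I : Λ, ¬ adj I I) :
    GraphProduct adj G →* (∀ I, G I) :=
  QuotientGroup.lift _ (Monoid.CoprodI.lift fun I => MonoidHom.mulSingle G I)
    (Subgroup.normalClosure_le_normal (by
      rintro g ⟨I, J, x, y, hadj, rfl⟩
      have hIJ : I ≠ J := fun h => hirr J (h ▸ hadj)
      have hc : Commute (Pi.mulSingle I x) (Pi.mulSingle J y) :=
        Pi.mulSingle_commute hIJ x y
      simp only [SetLike.mem_coe, MonoidHom.mem_ker, map_mul, map_inv,
        Monoid.CoprodI.lift_of, MonoidHom.mulSingle_apply]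
      rw [hc.eq]
      group))

section InitialParts

variable {Λ : Type u} {G : Λ → Type v} [∀ I, Group (G I)] {adj : Λ → Λ → Prop}

/-- The syllable at `I` given by a nontrivial element of `G I`. -/
abbrev Syllable.of (I : Λ) (g : {g : G I // g ≠ 1}) : Syllable G := ⟨I, g⟩

theorem Syllable.exists_eq_of {I : Λ} {s : Syllable G} (h : s.1 = I) :
    ∃ g, s = Syllable.of I g := by
  subst h
  exact ⟨s.2, rfl⟩

open Classical in
/-- The component in `G I` of a syllable, trivial when the syllable is at another vertex. -/
noncomputable def Syllable.coord (I : Λ) (s : Syllable G) : G I :=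
  if h : s.1 = I then h ▸ s.2.1 else 1

theorem Syllable.coord_same (I : Λ) (g : {g : G I // g ≠ 1}) :
    (Syllable.of I g).coord I = g.1 :=
  dif_pos rfl

theorem Syllable.coord_self (s : Syllable G) : s.coord s.1 = s.2.1 := by
  exact dif_pos rfl

theorem Syllable.coord_of_ne {I : Λ} {s : Syllable G} (h : s.1 ≠ I) : s.coord I = 1 :=
  dif_neg h

open Classical in
/-- The product of the syllables at `I` which precede every syllable blocking `I`. -/
noncomputable def wordHead (adj : Λ → Λ → Prop) (I : Λ) : List (Syllable G) → G I
  | [] => 1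
  | s :: L => if s.1 = I ∨ adj s.1 I then s.coord I * wordHead adj I L else 1

open Classical in
/-- The word obtained by deleting the first initial syllable at `I`, if there is one. -/
noncomputable def wordTail (adj : Λ → Λ → Prop) (I : Λ) : List (Syllable G) → List (Syllable G)
  | [] => []
  | s :: L => if s.1 = I then L else if adj s.1 I then s :: wordTail adj I L else s :: L

open Classical in
/-- Prepend an element of `G I` to a word, omitting it if it is trivial. -/
noncomputable def consPart (I : Λ) (g : G I) (L : List (Syllable G)) : List (Syllable G) :=
  if h : g = 1 then L else Syllable.of I ⟨g, h⟩ :: L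

/-- Recursive form of reducedness: no syllable can be amalgamated with a later one. -/
def NormalForm (adj : Λ → Λ → Prop) : List (Syllable G) → Prop
  | [] => True
  | s :: L => wordHead adj s.1 L = 1 ∧ NormalForm adj L

@[simp] theorem wordHead_nil (I : Λ) : wordHead adj I ([] : List (Syllable G)) = 1 := rfl

@[simp] theorem wordTail_nil (I : Λ) : wordTail adj I ([] : List (Syllable G)) = [] := rfl

theorem wordHead_same (I : Λ) (g : {g : G I // g ≠ 1}) (L : List (Syllable G)) :
    wordHead adj I (Syllable.of I g :: L) = g.1 * wordHead adj I L :=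
  (if_pos (Or.inl rfl)).trans (by rw [Syllable.coord_same])

theorem wordHead_cons_self (s : Syllable G) (L : List (Syllable G)) :
    wordHead adj s.1 (s :: L) = s.2.1 * wordHead adj s.1 L := by
  rw [wordHead, if_pos (Or.inl rfl), Syllable.coord_self]

theorem ne_of_adj (hirr : ∀ I : Λ, ¬ adj I I) {I J : Λ} (h : adj I J) : I ≠ J := by
  rintro rfl
  exact hirr I h

theorem wordHead_adj (hirr : ∀ I : Λ, ¬ adj I I) {I : Λ} {s : Syllable G} (h : adj s.1 I)
    (L : List (Syllable G)) : wordHead adj I (s :: L) = wordHead adj I L := by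
  rw [wordHead, if_pos (Or.inr h), Syllable.coord_of_ne (ne_of_adj hirr h), one_mul]

theorem wordHead_block {I : Λ} {s : Syllable G} (h : s.1 ≠ I) (h' : ¬ adj s.1 I)
    (L : List (Syllable G)) : wordHead adj I (s :: L) = 1 := by
  rw [wordHead, if_neg (by tauto)]

theorem wordTail_same {I : Λ} {s : Syllable G} (h : s.1 = I) (L : List (Syllable G)) :
    wordTail adj I (s :: L) = L := by
  rw [wordTail, if_pos h]

theorem wordTail_of_same (I : Λ) (g : {g : G I // g ≠ 1}) (L : List (Syllable G)) :
    wordTail adj I (Syllable.of I g :: L) = L :=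
  if_pos rfl

theorem wordTail_adj (hirr : ∀ I : Λ, ¬ adj I I) {I : Λ} {s : Syllable G} (h : adj s.1 I)
    (L : List (Syllable G)) : wordTail adj I (s :: L) = s :: wordTail adj I L := by
  rw [wordTail, if_neg (ne_of_adj hirr h), if_pos h]

theorem wordTail_block {I : Λ} {s : Syllable G} (h : s.1 ≠ I) (h' : ¬ adj s.1 I)
    (L : List (Syllable G)) : wordTail adj I (s :: L) = s :: L := by
  rw [wordTail, if_neg h, if_neg h']

theorem consPart_one (I : Λ) (L : List (Syllable G)) : consPart I 1 L = L := dif_pos rfl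

theorem consPart_of_ne {I : Λ} {g : G I} (h : g ≠ 1) (L : List (Syllable G)) :
    consPart I g L = Syllable.of I ⟨g, h⟩ :: L := dif_neg h

namespace ShuffleEquiv

theorem refl (L : List (Syllable G)) : ShuffleEquiv adj L L := Relation.ReflTransGen.refl

theorem trans {L M N : List (Syllable G)} (h : ShuffleEquiv adj L M)
    (h' : ShuffleEquiv adj M N) : ShuffleEquiv adj L N := Relation.ReflTransGen.trans h h'

theorem symm (hsymm : ∀ ⦃I J : Λ⦄, adj I J → adj J I) {L M : List (Syllable G)} (h : ShuffleEquiv adj L M) :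
    ShuffleEquiv adj M L := by
  induction h with
  | refl => exact refl _
  | tail _ h ih =>
    obtain ⟨A, B, s, t, hst, rfl, rfl⟩ := h
    exact trans (Relation.ReflTransGen.single ⟨A, B, t, s, hsymm hst, rfl, rfl⟩) ih

theorem cons (s : Syllable G) {L M : List (Syllable G)} (h : ShuffleEquiv adj L M) :
    ShuffleEquiv adj (s :: L) (s :: M) := by
  refine Relation.ReflTransGen.lift (s :: ·) ?_ _ _ h
  rintro _ _ ⟨A, B, a, b, hab, rfl, rfl⟩
  exact ⟨s :: A, B, a, b, hab, rfl, rfl⟩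

theorem swap {s t : Syllable G} (h : adj s.1 t.1) (L : List (Syllable G)) :
    ShuffleEquiv adj (s :: t :: L) (t :: s :: L) :=
  Relation.ReflTransGen.single ⟨[], L, s, t, h, rfl, rfl⟩

theorem prepend (I : Λ) (g : G I) {L M : List (Syllable G)} (h : ShuffleEquiv adj L M) :
    ShuffleEquiv adj (consPart I g L) (consPart I g M) := by
  unfold consPart
  split
  · exact h
  · exact h.cons _

end ShuffleEquiv

theorem consPart_comm {I J : Λ} (h : adj I J) (g : G I) (k : G J) (L : List (Syllable G)) :
    ShuffleEquiv adj (consPart I g (consPart J k L)) (consPart J k (consPart I g L)) := by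
  by_cases hg : g = 1
  · subst hg; simpa only [consPart_one] using ShuffleEquiv.refl _
  by_cases hk : k = 1
  · subst hk; simpa only [consPart_one] using ShuffleEquiv.refl _
  rw [consPart_of_ne hg, consPart_of_ne hk, consPart_of_ne hg, consPart_of_ne hk]
  exact ShuffleEquiv.swap h L

theorem wordHead_swap (hsymm : ∀ ⦃I J : Λ⦄, adj I J → adj J I) (hirr : ∀ I : Λ, ¬ adj I I) (I : Λ)
    {s t : Syllable G} (h : adj s.1 t.1) (L : List (Syllable G)) :
    wordHead adj I (s :: t :: L) = wordHead adj I (t :: s :: L) := by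
  have key : ∀ {s t : Syllable G}, adj s.1 t.1 → s.1 = I →
      wordHead adj I (s :: t :: L) = wordHead adj I (t :: s :: L) := by
    intro s t h hs
    subst hs
    have h' := hsymm h
    rw [wordHead_cons_self, wordHead_adj hirr h', wordHead_adj hirr h', wordHead_cons_self]
  by_cases hs : s.1 = I
  · exact key h hs
  by_cases ht : t.1 = I
  · exact (key (hsymm h) ht).symm
  by_cases hsI : adj s.1 I <;> by_cases htI : adj t.1 I <;>
    simp only [wordHead_adj hirr, wordHead_block, hs, ht, hsI, htI, ne_eq, not_false_eq_true]

theorem wordTail_swap (hsymm : ∀ ⦃I J : Λ⦄, adj I J → adj J I) (hirr : ∀ I : Λ, ¬ adj I I) (I : Λ)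
    {s t : Syllable G} (h : adj s.1 t.1) (L : List (Syllable G)) :
    ShuffleEquiv adj (wordTail adj I (s :: t :: L)) (wordTail adj I (t :: s :: L)) := by
  by_cases hs : s.1 = I
  · subst hs
    rw [wordTail_same rfl, wordTail_adj hirr (hsymm h), wordTail_same rfl]
    exact ShuffleEquiv.refl _
  by_cases ht : t.1 = I
  · subst ht
    rw [wordTail_same rfl, wordTail_adj hirr h, wordTail_same rfl]
    exact ShuffleEquiv.refl _
  by_cases hsI : adj s.1 I <;> by_cases htI : adj t.1 I <;>
    simp only [wordTail_adj hirr, wordTail_block, hs, ht, hsI, htI, ne_eq, not_false_eq_true] <;>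
    exact ShuffleEquiv.swap h _

theorem ShuffleStep.wordHead_eq (hsymm : ∀ ⦃I J : Λ⦄, adj I J → adj J I) (hirr : ∀ I : Λ, ¬ adj I I) (I : Λ)
    {L M : List (Syllable G)} (h : ShuffleStep adj L M) :
    wordHead adj I L = wordHead adj I M := by
  obtain ⟨A, B, s, t, hst, rfl, rfl⟩ := h
  induction A with
  | nil => exact wordHead_swap hsymm hirr I hst B
  | cons a A ih => simp only [List.cons_append, wordHead, ih]

theorem ShuffleEquiv.wordHead_eq (hsymm : ∀ ⦃I J : Λ⦄, adj I J → adj J I) (hirr : ∀ I : Λ, ¬ adj I I) (I : Λ)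
    {L M : List (Syllable G)} (h : ShuffleEquiv adj L M) :
    wordHead adj I L = wordHead adj I M := by
  induction h with
  | refl => rfl
  | tail _ h ih => exact ih.trans (h.wordHead_eq hsymm hirr I)

theorem ShuffleStep.wordTail_equiv (hsymm : ∀ ⦃I J : Λ⦄, adj I J → adj J I) (hirr : ∀ I : Λ, ¬ adj I I) (I : Λ)
    {L M : List (Syllable G)} (h : ShuffleStep adj L M) :
    ShuffleEquiv adj (wordTail adj I L) (wordTail adj I M) := by
  obtain ⟨A, B, s, t, hst, rfl, rfl⟩ := h
  induction A with
  | nil => exact wordTail_swap hsymm hirr I hst B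
  | cons a A ih =>
    have hAB : ShuffleEquiv adj (A ++ s :: t :: B) (A ++ t :: s :: B) :=
      Relation.ReflTransGen.single ⟨A, B, s, t, hst, rfl, rfl⟩
    simp only [List.cons_append, wordTail]
    split_ifs
    · exact hAB
    · exact ih.cons a
    · exact hAB.cons a

theorem ShuffleEquiv.wordTail_equiv (hsymm : ∀ ⦃I J : Λ⦄, adj I J → adj J I) (hirr : ∀ I : Λ, ¬ adj I I) (I : Λ)
    {L M : List (Syllable G)} (h : ShuffleEquiv adj L M) :
    ShuffleEquiv adj (wordTail adj I L) (wordTail adj I M) := by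
  induction h with
  | refl => exact ShuffleEquiv.refl _
  | tail _ h ih => exact ih.trans (h.wordTail_equiv hsymm hirr I)

theorem ShuffleStep.normalForm (hsymm : ∀ ⦃I J : Λ⦄, adj I J → adj J I) (hirr : ∀ I : Λ, ¬ adj I I)
    {L M : List (Syllable G)} (h : ShuffleStep adj L M) (hL : NormalForm adj L) :
    NormalForm adj M := by
  obtain ⟨A, B, s, t, hst, rfl, rfl⟩ := h
  induction A with
  | nil =>
    obtain ⟨hs, ht, hB⟩ := hL
    rw [wordHead_adj hirr (hsymm hst)] at hs
    exact ⟨by rw [wordHead_adj hirr hst]; exact ht, hs, hB⟩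
  | cons a A ih =>
    refine ⟨?_, ih hL.2⟩
    exact (ShuffleStep.wordHead_eq hsymm hirr a.1 ⟨A, B, s, t, hst, rfl, rfl⟩).symm.trans hL.1

theorem ShuffleEquiv.normalForm (hsymm : ∀ ⦃I J : Λ⦄, adj I J → adj J I) (hirr : ∀ I : Λ, ¬ adj I I)
    {L M : List (Syllable G)} (h : ShuffleEquiv adj L M) (hL : NormalForm adj L) :
    NormalForm adj M := by
  induction h with
  | refl => exact hL
  | tail _ h ih => exact h.normalForm hsymm hirr ih

theorem NormalForm.not_amalgamable {L : List (Syllable G)} (hL : NormalForm adj L) :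
    ¬ Amalgamable L := by
  rintro ⟨A, B, s, t, hst, rfl⟩
  induction A with
  | nil =>
    obtain ⟨h, h', -⟩ := hL
    obtain ⟨g, rfl⟩ := Syllable.exists_eq_of hst.symm
    rw [wordHead_same, h', mul_one] at h
    exact g.2 h
  | cons a A ih => exact ih hL.2

/-- A word with a nontrivial head at `I` can be shuffled so as to begin with a syllable
at `I`. -/
theorem exists_shuffleEquiv_cons {I : Λ} {L : List (Syllable G)} (h : wordHead adj I L ≠ 1) :
    ∃ (g : {g : G I // g ≠ 1}) (M : List (Syllable G)),
      ShuffleEquiv adj L (Syllable.of I g :: M) := by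
  induction L with
  | nil => exact absurd rfl h
  | cons s L ih =>
    by_cases hs : s.1 = I
    · obtain ⟨g, rfl⟩ := Syllable.exists_eq_of hs
      exact ⟨g, L, ShuffleEquiv.refl _⟩
    by_cases hsI : adj s.1 I
    · rw [wordHead, if_pos (Or.inr hsI), Syllable.coord_of_ne hs, one_mul] at h
      obtain ⟨g, M, hM⟩ := ih h
      exact ⟨g, s :: M, (hM.cons s).trans (ShuffleEquiv.swap hsI M)⟩
    · exact absurd (wordHead_block hs hsI L) h

theorem reduced_iff_normalForm (hsymm : ∀ ⦃I J : Λ⦄, adj I J → adj J I) (hirr : ∀ I : Λ, ¬ adj I I)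
    {L : List (Syllable G)} : Reduced adj L ↔ NormalForm adj L := by
  refine ⟨fun h => ?_, fun h => ?_⟩
  · induction L with
    | nil => trivial
    | cons s L ih =>
      refine ⟨?_, ih ?_⟩
      · by_contra hne
        obtain ⟨g, M, hM⟩ := exists_shuffleEquiv_cons hne
        exact h ⟨_, hM.cons s, [], M, s, .of s.1 g, rfl, rfl⟩
      · rintro ⟨M, hM, A, B, a, b, hab, rfl⟩
        exact h ⟨_, hM.cons s, s :: A, B, a, b, hab, rfl⟩
  · rintro ⟨M, hM, hA⟩
    exact (hM.normalForm hsymm hirr h).not_amalgamable hA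

theorem NormalForm.wordTail_eq_self {I : Λ} {L : List (Syllable G)}
    (hL : NormalForm adj L) (h : wordHead adj I L = 1) : wordTail adj I L = L := by
  induction L with
  | nil => rfl
  | cons s L ih =>
    by_cases hs : s.1 = I
    · subst hs
      rw [wordHead_cons_self, hL.1, mul_one] at h
      exact absurd h s.2.2
    by_cases hsI : adj s.1 I
    · rw [wordHead, if_pos (Or.inr hsI), Syllable.coord_of_ne hs, one_mul] at h
      rw [wordTail, if_neg hs, if_pos hsI, ih hL.2 h]
    · exact wordTail_block hs hsI L

theorem NormalForm.wordHead_wordTail (hirr : ∀ I : Λ, ¬ adj I I) (I : Λ)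
    {L : List (Syllable G)} (hL : NormalForm adj L) :
    wordHead adj I (wordTail adj I L) = 1 := by
  induction L with
  | nil => rfl
  | cons s L ih =>
    by_cases hs : s.1 = I
    · subst hs
      rw [wordTail_same rfl, hL.1]
    by_cases hsI : adj s.1 I
    · rw [wordTail_adj hirr hsI, wordHead_adj hirr hsI, ih hL.2]
    · rw [wordTail_block hs hsI, wordHead_block hs hsI]

theorem wordHead_wordTail_of_adj (hirr : ∀ I : Λ, ¬ adj I I) {I J : Λ} (h : adj I J)
    (L : List (Syllable G)) : wordHead adj J (wordTail adj I L) = wordHead adj J L := by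
  induction L with
  | nil => rfl
  | cons s L ih =>
    by_cases hs : s.1 = I
    · subst hs
      rw [wordTail_same rfl, wordHead_adj hirr h]
    by_cases hsI : adj s.1 I
    · rw [wordTail_adj hirr hsI, wordHead, wordHead, ih]
    · rw [wordTail_block hs hsI]

theorem NormalForm.tail (hirr : ∀ I : Λ, ¬ adj I I) (hsymm : ∀ ⦃I J : Λ⦄, adj I J → adj J I) (I : Λ)
    {L : List (Syllable G)} (hL : NormalForm adj L) : NormalForm adj (wordTail adj I L) := by
  induction L with
  | nil => trivial
  | cons s L ih =>
    by_cases hs : s.1 = I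
    · rw [wordTail_same hs]
      exact hL.2
    by_cases hsI : adj s.1 I
    · rw [wordTail_adj hirr hsI]
      exact ⟨(wordHead_wordTail_of_adj hirr (hsymm hsI) L).trans hL.1, ih hL.2⟩
    · rwa [wordTail_block hs hsI]

theorem wordTail_comm (hsymm : ∀ ⦃I J : Λ⦄, adj I J → adj J I) (hirr : ∀ I : Λ, ¬ adj I I) {I J : Λ}
    (h : adj I J) (L : List (Syllable G)) :
    wordTail adj I (wordTail adj J L) = wordTail adj J (wordTail adj I L) := by
  induction L with
  | nil => rfl
  | cons s L ih =>
    by_cases hsI : s.1 = I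
    · subst hsI
      rw [wordTail_adj hirr h, wordTail_same rfl, wordTail_same rfl]
    by_cases hsJ : s.1 = J
    · subst hsJ
      rw [wordTail_adj hirr (hsymm h), wordTail_same rfl, wordTail_same rfl]
    by_cases haI : adj s.1 I <;> by_cases haJ : adj s.1 J <;>
      simp only [wordTail_adj hirr, wordTail_block, hsI, hsJ, haI, haJ, ne_eq,
        not_false_eq_true, ih]

theorem wordHead_consPart_same {I : Λ} (g : G I) {L : List (Syllable G)}
    (h : wordHead adj I L = 1) : wordHead adj I (consPart I g L) = g := by
  by_cases hg : g = 1
  · rw [hg, consPart_one, h]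
  · rw [consPart_of_ne hg, wordHead_same, h, mul_one]

theorem wordTail_consPart_same {I : Λ} (g : G I) {L : List (Syllable G)}
    (hL : NormalForm adj L) (h : wordHead adj I L = 1) :
    wordTail adj I (consPart I g L) = L := by
  by_cases hg : g = 1
  · rw [hg, consPart_one, hL.wordTail_eq_self h]
  · rw [consPart_of_ne hg, wordTail_of_same]

theorem wordHead_consPart_of_adj (hirr : ∀ I : Λ, ¬ adj I I) {I J : Λ} (h : adj J I) (g : G J)
    (L : List (Syllable G)) : wordHead adj I (consPart J g L) = wordHead adj I L := by
  by_cases hg : g = 1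
  · rw [hg, consPart_one]
  · rw [consPart_of_ne hg, wordHead_adj (s := .of J ⟨g, hg⟩) hirr h]

theorem wordTail_consPart_of_adj (hirr : ∀ I : Λ, ¬ adj I I) {I J : Λ} (h : adj J I) (g : G J)
    (L : List (Syllable G)) :
    wordTail adj I (consPart J g L) = consPart J g (wordTail adj I L) := by
  by_cases hg : g = 1
  · rw [hg, consPart_one, consPart_one]
  · rw [consPart_of_ne hg, wordTail_adj (s := .of J ⟨g, hg⟩) hirr h, consPart_of_ne hg]

theorem NormalForm.prepend {I : Λ} (g : G I) {L : List (Syllable G)}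
    (hL : NormalForm adj L) (h : wordHead adj I L = 1) : NormalForm adj (consPart I g L) := by
  by_cases hg : g = 1
  · rwa [hg, consPart_one]
  · rw [consPart_of_ne hg]
    exact ⟨h, hL⟩

theorem NormalForm.prepend_wordHead_wordTail (hsymm : ∀ ⦃I J : Λ⦄, adj I J → adj J I)
    (hirr : ∀ I : Λ, ¬ adj I I) (I : Λ) {L : List (Syllable G)} (hL : NormalForm adj L) :
    ShuffleEquiv adj (consPart I (wordHead adj I L) (wordTail adj I L)) L := by
  induction L with
  | nil => rw [wordHead_nil, consPart_one]; exact ShuffleEquiv.refl _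
  | cons s L ih =>
    by_cases hs : s.1 = I
    · obtain ⟨g, rfl⟩ := Syllable.exists_eq_of hs
      have h1 : wordHead adj I L = 1 := hL.1
      rw [wordTail_of_same, wordHead_same, h1, mul_one, consPart_of_ne g.2]
      exact ShuffleEquiv.refl _
    by_cases hsI : adj s.1 I
    · rw [wordTail_adj hirr hsI, wordHead_adj hirr hsI]
      have h := consPart_comm (hsymm hsI) (wordHead adj I L) s.2.1 (wordTail adj I L)
      rw [consPart_of_ne s.2.2, consPart_of_ne s.2.2] at h
      exact h.trans ((ih hL.2).cons s)
    · rw [wordTail_block hs hsI, wordHead_block hs hsI, consPart_one]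
      exact ShuffleEquiv.refl _

end InitialParts

section Action

variable {Λ : Type u} {G : Λ → Type v} [∀ I, Group (G I)] {adj : Λ → Λ → Prop}

/-- Shuffle equivalence as a setoid on normal forms. -/
def shuffleSetoid (G : Λ → Type v) [∀ I, Group (G I)] (hsymm : ∀ ⦃I J : Λ⦄, adj I J → adj J I) :
    Setoid {L : List (Syllable G) // NormalForm adj L} where
  r L M := ShuffleEquiv adj L.1 M.1
  iseqv := ⟨fun L => ShuffleEquiv.refl L.1, fun h => h.symm hsymm, fun h h' => h.trans h'⟩

/-- Left multiplication of a normal form by an element of `G I`. -/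
noncomputable def mulNormalForm (hsymm : ∀ ⦃I J : Λ⦄, adj I J → adj J I) (hirr : ∀ I : Λ, ¬ adj I I) {I : Λ}
    (g : G I) (L : {L : List (Syllable G) // NormalForm adj L}) :
    {L : List (Syllable G) // NormalForm adj L} :=
  ⟨consPart I (g * wordHead adj I L.1) (wordTail adj I L.1),
    (L.2.tail hirr hsymm I).prepend _ (L.2.wordHead_wordTail hirr I)⟩

/-- The action of `G I` on shuffle classes of normal forms. -/
noncomputable def partAction (hsymm : ∀ ⦃I J : Λ⦄, adj I J → adj J I) (hirr : ∀ I : Λ, ¬ adj I I) (I : Λ) :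
    G I →* Function.End (Quotient (shuffleSetoid G hsymm)) where
  toFun g := Quotient.map (mulNormalForm hsymm hirr g) (by
    intro L M h
    have h' : ShuffleEquiv adj L.1 M.1 := h
    change ShuffleEquiv adj (consPart _ _ _) (consPart _ _ _)
    rw [h'.wordHead_eq hsymm hirr I]
    exact (h'.wordTail_equiv hsymm hirr I).prepend _ _)
  map_one' := by
    funext q
    induction q using Quotient.inductionOn with
    | h L =>
      refine Quotient.sound ?_
      change ShuffleEquiv adj (consPart _ _ _) _
      rw [one_mul]
      exact L.2.prepend_wordHead_wordTail hsymm hirr I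
  map_mul' g k := by
    funext q
    induction q using Quotient.inductionOn with
    | h L =>
      refine congrArg (Quotient.mk _) (Subtype.ext ?_)
      simp only [mulNormalForm]
      rw [wordHead_consPart_same _ (L.2.wordHead_wordTail hirr I),
        wordTail_consPart_same _ (L.2.tail hirr hsymm I) (L.2.wordHead_wordTail hirr I),
        mul_assoc]

theorem partAction_mk (hsymm : ∀ ⦃I J : Λ⦄, adj I J → adj J I) (hirr : ∀ I : Λ, ¬ adj I I) {I : Λ} (g : G I)
    (L : {L : List (Syllable G) // NormalForm adj L}) :
    partAction hsymm hirr I g (Quotient.mk (shuffleSetoid G hsymm) L) =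
      Quotient.mk (shuffleSetoid G hsymm) (mulNormalForm hsymm hirr g L) := rfl

theorem partAction_comm (hsymm : ∀ ⦃I J : Λ⦄, adj I J → adj J I) (hirr : ∀ I : Λ, ¬ adj I I) {I J : Λ}
    (h : adj I J) (g : G I) (k : G J) :
    partAction hsymm hirr I g * partAction hsymm hirr J k =
      partAction hsymm hirr J k * partAction hsymm hirr I g := by
  funext q
  induction q using Quotient.inductionOn with
  | h L =>
    refine Quotient.sound ?_
    change ShuffleEquiv adj (consPart _ _ _) (consPart _ _ _)
    simp only [mulNormalForm]
    rw [wordHead_consPart_of_adj hirr (hsymm h), wordHead_consPart_of_adj hirr h,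
      wordTail_consPart_of_adj hirr (hsymm h), wordTail_consPart_of_adj hirr h,
      wordHead_wordTail_of_adj hirr (hsymm h), wordHead_wordTail_of_adj hirr h,
      wordTail_comm hsymm hirr h]
    exact consPart_comm h _ _ _

/-- The action of the graph product on shuffle classes of normal forms. -/
noncomputable def graphProductAction (hsymm : ∀ ⦃I J : Λ⦄, adj I J → adj J I) (hirr : ∀ I : Λ, ¬ adj I I) :
    GraphProduct adj G →* Function.End (Quotient (shuffleSetoid G hsymm)) :=
  QuotientGroup.lift _ (Monoid.CoprodI.lift (partAction hsymm hirr))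
    (Subgroup.normalClosure_le_normal (by
      rintro _ ⟨I, J, x, y, h, rfl⟩
      simp only [SetLike.mem_coe, MonoidHom.mem_ker, map_mul, Monoid.CoprodI.lift_of,
        ← map_inv]
      rw [partAction_comm hsymm hirr h, mul_assoc (partAction hsymm hirr J y), ← map_mul,
        mul_inv_cancel, map_one, mul_one, ← map_mul, mul_inv_cancel, map_one]))

theorem graphProductAction_mkOf (hsymm : ∀ ⦃I J : Λ⦄, adj I J → adj J I) (hirr : ∀ I : Λ, ¬ adj I I) {I : Λ}
    (g : G I) :
    graphProductAction hsymm hirr (mkOf adj G g) = partAction hsymm hirr I g := by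
  change Monoid.CoprodI.lift (partAction hsymm hirr) (Monoid.CoprodI.of g) = _
  rw [Monoid.CoprodI.lift_of]

theorem evalWord_nil : evalWord adj G [] = 1 := rfl

theorem evalWord_cons (s : Syllable G) (L : List (Syllable G)) :
    evalWord adj G (s :: L) = mkOf adj G s.2.1 * evalWord adj G L := by
  simp [evalWord]

theorem evalWord_append (L M : List (Syllable G)) :
    evalWord adj G (L ++ M) = evalWord adj G L * evalWord adj G M := by
  simp [evalWord]

theorem graphProductAction_evalWord (hsymm : ∀ ⦃I J : Λ⦄, adj I J → adj J I) (hirr : ∀ I : Λ, ¬ adj I I)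
    {L : List (Syllable G)} (hL : NormalForm adj L) :
    graphProductAction hsymm hirr (evalWord adj G L)
      (Quotient.mk (shuffleSetoid G hsymm) ⟨[], trivial⟩) =
      Quotient.mk (shuffleSetoid G hsymm) ⟨L, hL⟩ := by
  induction L with
  | nil => rw [evalWord_nil, map_one]; rfl
  | cons s L ih =>
    rw [evalWord_cons, map_mul, graphProductAction_mkOf]
    change partAction hsymm hirr s.1 s.2.1 (graphProductAction hsymm hirr _ _) = _
    rw [ih hL.2, partAction_mk]
    refine congrArg (Quotient.mk _) (Subtype.ext ?_)
    simp only [mulNormalForm]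
    rw [hL.1, mul_one, hL.2.wordTail_eq_self hL.1, consPart_of_ne s.2.2]
    rfl

/-- Normal forms of the same element of a graph product are shuffle equivalent. -/
theorem NormalForm.shuffleEquiv (hsymm : ∀ ⦃I J : Λ⦄, adj I J → adj J I) (hirr : ∀ I : Λ, ¬ adj I I)
    {L M : List (Syllable G)} (hL : NormalForm adj L) (hM : NormalForm adj M)
    (h : evalWord adj G L = evalWord adj G M) : ShuffleEquiv adj L M := by
  have h1 := graphProductAction_evalWord hsymm hirr hL
  rw [h, graphProductAction_evalWord hsymm hirr hM] at h1
  exact Quotient.exact h1.symm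

theorem mkOf_one (I : Λ) : mkOf adj G (1 : G I) = 1 := by
  rw [mkOf, map_one]; rfl

theorem mkOf_mul {I : Λ} (g k : G I) :
    mkOf adj G (g * k) = mkOf adj G g * mkOf adj G k := by
  rw [mkOf, map_mul]; rfl

theorem mkOf_comm {I J : Λ} (h : adj I J) (g : G I) (k : G J) :
    mkOf adj G g * mkOf adj G k = mkOf adj G k * mkOf adj G g := by
  refine (QuotientGroup.eq.2 (?_ : (Monoid.CoprodI.of k * Monoid.CoprodI.of g)⁻¹ *
    (Monoid.CoprodI.of g * Monoid.CoprodI.of k) ∈ _)).symm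
  refine Subgroup.subset_normalClosure ⟨I, J, g⁻¹, k⁻¹, h, ?_⟩
  simp [mul_assoc]

theorem evalWord_consPart (I : Λ) (g : G I) (L : List (Syllable G)) :
    evalWord adj G (consPart I g L) = mkOf adj G g * evalWord adj G L := by
  by_cases hg : g = 1
  · rw [hg, consPart_one, mkOf_one, one_mul]
  · rw [consPart_of_ne hg, evalWord_cons]

theorem ShuffleEquiv.evalWord_eq {L M : List (Syllable G)} (h : ShuffleEquiv adj L M) :
    evalWord adj G L = evalWord adj G M := by
  induction h with
  | refl => rfl
  | tail _ h ih =>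
    obtain ⟨A, B, s, t, hst, rfl, rfl⟩ := h
    rw [ih, evalWord_append, evalWord_append, evalWord_cons, evalWord_cons, evalWord_cons,
      evalWord_cons, ← mul_assoc (mkOf adj G s.2.1), mkOf_comm hst, mul_assoc]

/-- The head of a normal form is the initial part of the element it represents. -/
theorem InitialPart.eq_wordHead (hsymm : ∀ ⦃I J : Λ⦄, adj I J → adj J I) (hirr : ∀ I : Λ, ¬ adj I I)
    {x : GraphProduct adj G} {I : Λ} {c : G I} (hc : InitialPart adj G x I c)
    {N : List (Syllable G)} (hN : NormalForm adj N) (hNx : evalWord adj G N = x) :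
    c = wordHead adj I N := by
  rcases hc with ⟨hne, L, hL, hLx, i, hi, hiL⟩ | ⟨rfl, hnot⟩
  · rw [reduced_iff_normalForm hsymm hirr] at hL
    rw [← (hL.shuffleEquiv hsymm hirr hN (hLx.trans hNx.symm)).wordHead_eq hsymm hirr I]
    clear hLx
    induction L with
    | nil => exact i.elim0
    | cons s L ih =>
      cases i using Fin.cases with
      | zero =>
        change s = _ at hiL
        subst hiL
        have h1 : wordHead adj I L = 1 := hL.1
        rw [wordHead_same, h1, mul_one]
      | succ i =>
        have hs : adj s.1 I := by
          have := hi 0 (Fin.succ_pos i)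
          rw [hiL] at this
          exact this
        rw [wordHead_adj hirr hs]
        exact ih hL.2 i (fun j hj => hi j.succ (Fin.succ_lt_succ_iff.2 hj)) hiL
  · by_contra hne
    have hne' : wordHead adj I N ≠ 1 := fun h => hne h.symm
    have hE := hN.prepend_wordHead_wordTail hsymm hirr I
    have hR : NormalForm adj (consPart I (wordHead adj I N) (wordTail adj I N)) :=
      hE.symm hsymm |>.normalForm hsymm hirr hN
    have hV := hE.evalWord_eq.trans hNx
    rw [consPart_of_ne hne'] at hR hV
    exact hnot ⟨_, ⟨_, (reduced_iff_normalForm hsymm hirr).2 hR, hV, ⟨0, by simp⟩,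
      fun j hj => absurd hj (Nat.not_lt_zero _), rfl⟩, rfl⟩

end Action

section Positive

variable {Λ : Type u} {G : Λ → Type v} [∀ I, Group (G I)] {adj : Λ → Λ → Prop}
  {Pc : ∀ I, Submonoid (G I)}

theorem exists_positive_word {x : GraphProduct adj G} (hx : x ∈ posCone adj G Pc) :
    ∃ W : List (Syllable G), (∀ s ∈ W, s.2.1 ∈ Pc s.1) ∧ evalWord adj G W = x := by
  induction hx using Submonoid.closure_induction with
  | mem x hx =>
    obtain ⟨I, p, hp, rfl⟩ := hx
    refine ⟨consPart I p [], ?_, by rw [evalWord_consPart, evalWord_nil, mul_one]⟩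
    by_cases h : p = 1
    · rw [h, consPart_one]; simp
    · rw [consPart_of_ne h]
      intro s hs
      obtain rfl := List.mem_singleton.1 hs
      exact hp
  | one => exact ⟨[], by simp, rfl⟩
  | mul x y _ _ hx hy =>
    obtain ⟨V, hV, rfl⟩ := hx
    obtain ⟨W, hW, rfl⟩ := hy
    exact ⟨V ++ W, fun s hs => (List.mem_append.1 hs).elim (hV s) (hW s),
      evalWord_append V W⟩

theorem Syllable.coord_mem (I : Λ) {s : Syllable G} (h : s.2.1 ∈ Pc s.1) :
    s.coord I ∈ Pc I := by
  by_cases hs : s.1 = I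
  · subst hs; rwa [Syllable.coord_self]
  · rw [Syllable.coord_of_ne hs]; exact one_mem _

theorem wordHead_mem (I : Λ) {W : List (Syllable G)} (hW : ∀ s ∈ W, s.2.1 ∈ Pc s.1) :
    wordHead adj I W ∈ Pc I := by
  induction W with
  | nil => exact one_mem _
  | cons s W ih =>
    rw [wordHead]
    split_ifs
    · exact mul_mem (Syllable.coord_mem I (hW s (by simp)))
        (ih fun t ht => hW t (List.mem_cons_of_mem _ ht))
    · exact one_mem _

/-- A positive word can be brought to normal form without changing its heads. -/
theorem exists_normalForm (hsymm : ∀ ⦃I J : Λ⦄, adj I J → adj J I) (hirr : ∀ I : Λ, ¬ adj I I)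
    (hpo : ∀ I, IsPoGroup (Pc I)) {W : List (Syllable G)} (hW : ∀ s ∈ W, s.2.1 ∈ Pc s.1) :
    ∃ N : List (Syllable G), NormalForm adj N ∧ evalWord adj G N = evalWord adj G W ∧
      ∀ I, wordHead adj I N = wordHead adj I W := by
  induction W with
  | nil => exact ⟨[], trivial, rfl, fun _ => rfl⟩
  | cons s W ih =>
    have hW' : ∀ t ∈ W, t.2.1 ∈ Pc t.1 := fun t ht => hW t (List.mem_cons_of_mem _ ht)
    obtain ⟨N, hN, hev, hhead⟩ := ih hW'
    obtain ⟨J, g, rfl⟩ : ∃ J g, s = Syllable.of J g := ⟨_, _, rfl⟩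
    have hg : g.1 ∈ Pc J := hW (.of J g) List.mem_cons_self
    have hne : g.1 * wordHead adj J N ≠ 1 := by
      intro h
      refine g.2 (hpo J _ hg ?_)
      rw [inv_eq_of_mul_eq_one_right h, hhead]
      exact wordHead_mem J hW'
    refine ⟨consPart J (g.1 * wordHead adj J N) (wordTail adj J N),
      (hN.tail hirr hsymm J).prepend _ (hN.wordHead_wordTail hirr J), ?_, fun I => ?_⟩
    · rw [evalWord_consPart, mkOf_mul, mul_assoc, ← evalWord_consPart,
        (hN.prepend_wordHead_wordTail hsymm hirr J).evalWord_eq, hev, evalWord_cons]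
    · by_cases hJ : J = I
      · subst hJ
        rw [wordHead_consPart_same _ (hN.wordHead_wordTail hirr J), wordHead_same, hhead]
      by_cases hJI : adj J I
      · rw [wordHead_consPart_of_adj hirr hJI, wordHead_wordTail_of_adj hirr hJI, hhead,
          wordHead_adj (s := .of J g) hirr hJI]
      · rw [consPart_of_ne hne, wordHead_block (s := .of J ⟨_, hne⟩) hJ hJI,
          wordHead_block (s := .of J g) hJ hJI]

theorem InitialPart.eq_wordHead_of_positive (hsymm : ∀ ⦃I J : Λ⦄, adj I J → adj J I)
    (hirr : ∀ I : Λ, ¬ adj I I) (hpo : ∀ I, IsPoGroup (Pc I)) {W : List (Syllable G)}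
    (hW : ∀ s ∈ W, s.2.1 ∈ Pc s.1) {I : Λ} {c : G I}
    (hc : InitialPart adj G (evalWord adj G W) I c) : c = wordHead adj I W := by
  obtain ⟨N, hN, hev, hhead⟩ := exists_normalForm hsymm hirr hpo hW
  rw [hc.eq_wordHead hsymm hirr hN hev, hhead]

theorem lle_wordHead_append (I : Λ) {V W : List (Syllable G)}
    (hW : ∀ s ∈ W, s.2.1 ∈ Pc s.1) :
    lle (Pc I) (wordHead adj I V) (wordHead adj I (V ++ W)) := by
  induction V with
  | nil => simpa [lle] using wordHead_mem I hW
  | cons s V ih =>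
    rw [List.cons_append, wordHead, wordHead]
    split_ifs
    · simpa [lle, mul_assoc] using ih
    · simp [lle]

variable [DecidableEq Λ]

theorem phi_mkOf (hirr : ∀ I : Λ, ¬ adj I I) {J : Λ} (g : G J) :
    phi adj G hirr (mkOf adj G g) = Pi.mulSingle J g := by
  change Monoid.CoprodI.lift (fun I => MonoidHom.mulSingle G I) (Monoid.CoprodI.of g) = _
  rw [Monoid.CoprodI.lift_of]
  rfl

theorem phi_evalWord_cons (hirr : ∀ I : Λ, ¬ adj I I) (I : Λ) (s : Syllable G)
    (L : List (Syllable G)) :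
    phi adj G hirr (evalWord adj G (s :: L)) I =
      s.coord I * phi adj G hirr (evalWord adj G L) I := by
  rw [evalWord_cons, map_mul, Pi.mul_apply, phi_mkOf]
  by_cases hs : s.1 = I
  · subst hs; rw [Pi.mulSingle_eq_same, Syllable.coord_self]
  · rw [Pi.mulSingle_eq_of_ne (Ne.symm hs), Syllable.coord_of_ne hs]

theorem phi_evalWord_mem (hirr : ∀ I : Λ, ¬ adj I I) (I : Λ) {W : List (Syllable G)}
    (hW : ∀ s ∈ W, s.2.1 ∈ Pc s.1) : phi adj G hirr (evalWord adj G W) I ∈ Pc I := by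
  induction W with
  | nil => rw [evalWord_nil, map_one]; exact one_mem _
  | cons s W ih =>
    rw [phi_evalWord_cons]
    exact mul_mem (Syllable.coord_mem I (hW s (by simp)))
      (ih fun t ht => hW t (List.mem_cons_of_mem _ ht))

theorem wordHead_lle_phi (hirr : ∀ I : Λ, ¬ adj I I) (I : Λ) {W : List (Syllable G)}
    (hW : ∀ s ∈ W, s.2.1 ∈ Pc s.1) :
    lle (Pc I) (wordHead adj I W) (phi adj G hirr (evalWord adj G W) I) := by
  induction W with
  | nil => simp [lle, evalWord_nil]
  | cons s W ih =>
    by_cases h : s.1 = I ∨ adj s.1 I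
    · rw [phi_evalWord_cons, wordHead, if_pos h]
      simpa [lle, mul_assoc] using ih fun t ht => hW t (List.mem_cons_of_mem _ ht)
    · rw [wordHead, if_neg h]
      simpa [lle] using phi_evalWord_mem hirr I hW

/-- Either every syllable at `I` is part of the head, or the head is unaffected by
appending further syllables. -/
theorem phi_eq_wordHead_or_wordHead_append (hirr : ∀ I : Λ, ¬ adj I I) (I : Λ)
    (V W : List (Syllable G)) :
    phi adj G hirr (evalWord adj G V) I = wordHead adj I V ∨
      wordHead adj I V = wordHead adj I (V ++ W) := by
  induction V with
  | nil => left; rw [evalWord_nil, map_one]; rfl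
  | cons s V ih =>
    rw [phi_evalWord_cons, List.cons_append, wordHead, wordHead]
    split_ifs
    · exact ih.imp (congrArg _) (congrArg _)
    · exact Or.inr rfl

/-- For `x ≤ z` in the positive cone: the initial part of `x` at `I` lies below that of `z`,
the remaining part of `φ(x)_I` is positive, and it is trivial unless the two initial parts
coincide. -/
theorem InitialPart.of_lle (hsymm : ∀ ⦃I J : Λ⦄, adj I J → adj J I) (hirr : ∀ I : Λ, ¬ adj I I)
    (hpo : ∀ I, IsPoGroup (Pc I)) {x z : GraphProduct adj G} (hx : x ∈ posCone adj G Pc)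
    (hxz : lle (posCone adj G Pc) x z) {I : Λ} {c d : G I} (hc : InitialPart adj G x I c)
    (hd : InitialPart adj G z I d) :
    lle (Pc I) c d ∧ lle (Pc I) c (phi adj G hirr x I) ∧
      lle (Pc I) (phi adj G hirr x I) (phi adj G hirr z I) ∧
      (phi adj G hirr x I = c ∨ c = d) := by
  obtain ⟨V, hV, rfl⟩ := exists_positive_word hx
  obtain ⟨W, hW, hz⟩ := exists_positive_word hxz
  obtain rfl : z = evalWord adj G (V ++ W) := by
    rw [evalWord_append, hz, mul_inv_cancel_left]
  have hVW : ∀ s ∈ V ++ W, s.2.1 ∈ Pc s.1 :=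
    fun s hs => (List.mem_append.1 hs).elim (hV s) (hW s)
  obtain rfl := hc.eq_wordHead_of_positive hsymm hirr hpo hV
  obtain rfl := hd.eq_wordHead_of_positive hsymm hirr hpo hVW
  refine ⟨lle_wordHead_append I hW, wordHead_lle_phi hirr I hV, ?_,
    phi_eq_wordHead_or_wordHead_append hirr I V W⟩
  rw [evalWord_append, map_mul, Pi.mul_apply, lle, inv_mul_cancel_left]
  exact phi_evalWord_mem hirr I hW

end Positive

theorem exists_initialPart {Λ : Type u} (adj : Λ → Λ → Prop) (G : Λ → Type v)
    [∀ I, Group (G I)] (x : GraphProduct adj G) (I : Λ) : ∃ c, InitialPart adj G x I c := by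
  by_cases h : InitialVertexOf adj G x I
  · obtain ⟨⟨J, g⟩, hs, rfl⟩ := h
    exact ⟨g.1, Or.inl ⟨g.2, hs⟩⟩
  · exact ⟨1, Or.inr ⟨rfl, h⟩⟩

section Joins

variable {H : Type*} [Group H] {P : Submonoid H}

theorem lle_refl (a : H) : lle P a a := by simp [lle]

theorem lle_mul_left_iff {a b c : H} : lle P (a * b) (a * c) ↔ lle P b c := by
  simp [lle, mul_assoc]

theorem lle_trans {a b c : H} (h : lle P a b) (h' : lle P b c) : lle P a c := by
  simpa [lle, mul_assoc] using mul_mem h h'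

theorem isLub'_of_lle {a b : H} (h : lle P b a) : IsLub' P a b a :=
  ⟨lle_refl a, h, fun _ hw _ => hw⟩

theorem IsLub'.symm {a b m : H} (h : IsLub' P a b m) : IsLub' P b a m :=
  ⟨h.2.1, h.1, fun w hb ha => h.2.2 w ha hb⟩

theorem IsLub'.mul_left {a b m : H} (c : H) (h : IsLub' P a b m) :
    IsLub' P (c * a) (c * b) (c * m) := by
  refine ⟨lle_mul_left_iff.2 h.1, lle_mul_left_iff.2 h.2.1, fun w ha hb => ?_⟩
  rw [← mul_inv_cancel_left c w, lle_mul_left_iff] at ha hb ⊢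
  exact h.2.2 _ ha hb

theorem exists_isLub'_mul (hP : IsQLO P) {a b a' b' h z : H} (ha : lle P a h)
    (hb : lle P b h) (ha' : a' ∈ P) (hb' : b' ∈ P) (hz : lle P (a * a') z)
    (hz' : lle P (b * b') z) (hah : a' = 1 ∨ a = h) (hbh : b' = 1 ∨ b = h) :
    ∃ m m', IsLub' P a b m ∧ IsLub' P a' b' m' ∧ IsLub' P (a * a') (b * b') (m * m') := by
  have one_lle : ∀ {c}, c ∈ P → lle P 1 c := fun hc => by simpa [lle] using hc
  have lle_mul : ∀ {c d}, d ∈ P → lle P c (c * d) := fun hd => by simpa [lle] using hd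
  rcases hah with rfl | rfl <;> rcases hbh with rfl | rfl
  · obtain ⟨m, hm⟩ := hP.2 a b ⟨h, ha, hb⟩
    exact ⟨m, 1, hm, isLub'_of_lle (lle_refl 1), by simpa only [mul_one] using hm⟩
  · refine ⟨b, b', (isLub'_of_lle ha).symm, (isLub'_of_lle (one_lle hb')).symm, ?_⟩
    rw [mul_one]
    exact (isLub'_of_lle (lle_trans ha (lle_mul hb'))).symm
  · refine ⟨a, a', isLub'_of_lle hb, isLub'_of_lle (one_lle ha'), ?_⟩
    rw [mul_one]
    exact isLub'_of_lle (lle_trans hb (lle_mul ha'))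
  · rw [← mul_inv_cancel_left b z, lle_mul_left_iff] at hz hz'
    obtain ⟨m', hm'⟩ := hP.2 a' b' ⟨_, hz, hz'⟩
    exact ⟨_, m', isLub'_of_lle (lle_refl _), hm', hm'.mul_left _⟩

end Joins

/-- Lemma 4.4. Let `(G,P)` be a graph product of quasi-lattice
ordered groups, `φ` the canonical homomorphism to the direct product.  If `x, y ∈ P` have
a common upper bound and, for an arbitrary `I ∈ Λ`, `x = x_I x′` and `y = y_I y′`, then
`φ(x)_I ∨ φ(y)_I = (x_I ∨ y_I) · (φ(x′)_I ∨ φ(y′)_I)`, all joins being taken in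
`(G_I, P_I)`. -/
theorem phi_coordinate_join {Λ : Type u} [DecidableEq Λ] (adj : Λ → Λ → Prop)
    (hsymm : Symmetric adj) (hirr : ∀ I : Λ, ¬ adj I I)
    (G : Λ → Type v) [∀ I, Group (G I)]
    (Pc : ∀ I, Submonoid (G I)) (hqlo : ∀ I, IsQLO (Pc I))
    (x y : GraphProduct adj G)
    (hx : x ∈ posCone adj G Pc) (hy : y ∈ posCone adj G Pc)
    (hub : HasUB (posCone adj G Pc) x y)
    (I : Λ) (xI yI : G I)
    (hxI : InitialPart adj G x I xI) (hyI : InitialPart adj G y I yI)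
    (x' y' : GraphProduct adj G)
    (hx' : x = mkOf adj G xI * x') (hy' : y = mkOf adj G yI * y') :
    ∃ mI m'I : G I,
      IsLub' (Pc I) xI yI mI ∧
      IsLub' (Pc I) (phi adj G hirr x' I) (phi adj G hirr y' I) m'I ∧
      IsLub' (Pc I) (phi adj G hirr x I) (phi adj G hirr y I) (mI * m'I) := by
  have hpo : ∀ J, IsPoGroup (Pc J) := fun J => (hqlo J).1
  obtain ⟨z, hxz, hyz⟩ := hub
  obtain ⟨d, hd⟩ := exists_initialPart adj G z I
  obtain ⟨hxd, hxφ, hxz', hx1⟩ := hxI.of_lle hsymm hirr hpo hx hxz hd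
  obtain ⟨hyd, hyφ, hyz', hy1⟩ := hyI.of_lle hsymm hirr hpo hy hyz hd
  have hφ : ∀ (c : G I) (u : GraphProduct adj G),
      phi adj G hirr (mkOf adj G c * u) I = c * phi adj G hirr u I := fun c u => by
    rw [map_mul, Pi.mul_apply, phi_mkOf, Pi.mulSingle_eq_same]
  rw [hx', hφ] at hxφ hxz' hx1 ⊢
  rw [hy', hφ] at hyφ hyz' hy1 ⊢
  rw [lle, inv_mul_cancel_left] at hxφ hyφ
  rw [mul_eq_left] at hx1 hy1
  exact exists_isLub'_mul (hqlo I) hxd hyd hxφ hyφ hxz' hyz' hx1 hy1
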